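/- Let ζ be an extremal number and ε > 0. Then there are arbitrarily large X such that the system H(α) ≤ X, |ζ − α| ≤ H(α)^{−1} X^{−√5−ε} has no solution in real algebraic numbers α of degree exactly three. -/

import Mathlib

open Polynomial

/-- Height of an integer polynomial: the maximum absolute value of its coefficients. -/
noncomputable def polyH (P : Polynomial ℤ) : ℝ :=
  (((P.support.sup fun i => (P.coeff i).natAbs) : ℕ) : ℝ)

/-- Evaluation of an integer polynomial at a real number. -/
noncomputable def pev (ζ : ℝ) (P : Polynomial ℤ) : ℝ := Polynomial.aeval ζ P

/-- Set of exponents η such that for arbitrarily large X the system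
    H(P) ≤ X, 0 < |P(ζ)| ≤ X^(−η) has a solution of degree at most n. -/
def wSet (n : ℕ) (ζ : ℝ) : Set ℝ :=
  {η | ∀ X₀ : ℝ, ∃ X : ℝ, X₀ ≤ X ∧ ∃ P : Polynomial ℤ,
    P.natDegree ≤ n ∧ polyH P ≤ X ∧ 0 < |pev ζ P| ∧ |pev ζ P| ≤ X ^ (-η)}

/-- The exponent w_n(ζ). -/
noncomputable def wExp (n : ℕ) (ζ : ℝ) : ℝ := sSup (wSet n ζ)

/-- Set of exponents η such that for all sufficiently large X the system
    H(P) ≤ X, 0 < |P(ζ)| ≤ X^(−η) has a solution of degree at most n. -/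
def whSet (n : ℕ) (ζ : ℝ) : Set ℝ :=
  {η | ∃ X₀ : ℝ, ∀ X : ℝ, X₀ ≤ X → ∃ P : Polynomial ℤ,
    P.natDegree ≤ n ∧ polyH P ≤ X ∧ 0 < |pev ζ P| ∧ |pev ζ P| ≤ X ^ (-η)}

/-- The uniform exponent ŵ_n(ζ). -/
noncomputable def whExp (n : ℕ) (ζ : ℝ) : ℝ := sSup (whSet n ζ)

/-- Set of exponents η such that for arbitrarily large X the system
    |x| ≤ X, max_{1≤i≤n} |ζ^i x − y_i| ≤ X^(−η) has a nonzero integer solution. -/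
def lamSet (n : ℕ) (ζ : ℝ) : Set ℝ :=
  {η | ∀ X₀ : ℝ, ∃ X : ℝ, X₀ ≤ X ∧ ∃ x : ℤ, ∃ y : Fin n → ℤ,
    (x ≠ 0 ∨ y ≠ 0) ∧ ((|x| : ℤ) : ℝ) ≤ X ∧
    ∀ i : Fin n, |ζ ^ ((i : ℕ) + 1) * (x : ℝ) - (y i : ℝ)| ≤ X ^ (-η)}

/-- The exponent λ_n(ζ). -/
noncomputable def lamExp (n : ℕ) (ζ : ℝ) : ℝ := sSup (lamSet n ζ)

/-- Set of exponents η such that for all sufficiently large X the system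
    |x| ≤ X, max_{1≤i≤n} |ζ^i x − y_i| ≤ X^(−η) has a nonzero integer solution. -/
def lamhSet (n : ℕ) (ζ : ℝ) : Set ℝ :=
  {η | ∃ X₀ : ℝ, ∀ X : ℝ, X₀ ≤ X → ∃ x : ℤ, ∃ y : Fin n → ℤ,
    (x ≠ 0 ∨ y ≠ 0) ∧ ((|x| : ℤ) : ℝ) ≤ X ∧
    ∀ i : Fin n, |ζ ^ ((i : ℕ) + 1) * (x : ℝ) - (y i : ℝ)| ≤ X ^ (-η)}

/-- The uniform exponent λ̂_n(ζ). -/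
noncomputable def lamhExp (n : ℕ) (ζ : ℝ) : ℝ := sSup (lamhSet n ζ)

/-- Set of exponents η such that for arbitrarily large X the polynomial system has
    at least j linearly independent solutions of degree at most n. -/
def wSetJ (n j : ℕ) (ζ : ℝ) : Set ℝ :=
  {η | ∀ X₀ : ℝ, ∃ X : ℝ, X₀ ≤ X ∧ ∃ P : Fin j → Polynomial ℤ,
    LinearIndependent ℤ P ∧ ∀ i : Fin j,
      (P i).natDegree ≤ n ∧ polyH (P i) ≤ X ∧ 0 < |pev ζ (P i)| ∧ |pev ζ (P i)| ≤ X ^ (-η)}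

/-- The exponent w_{n,j}(ζ). -/
noncomputable def wExpJ (n j : ℕ) (ζ : ℝ) : ℝ := sSup (wSetJ n j ζ)

/-- Set of exponents η such that for all sufficiently large X the polynomial system has
    at least j linearly independent solutions of degree at most n. -/
def whSetJ (n j : ℕ) (ζ : ℝ) : Set ℝ :=
  {η | ∃ X₀ : ℝ, ∀ X : ℝ, X₀ ≤ X → ∃ P : Fin j → Polynomial ℤ,
    LinearIndependent ℤ P ∧ ∀ i : Fin j,
      (P i).natDegree ≤ n ∧ polyH (P i) ≤ X ∧ 0 < |pev ζ (P i)| ∧ |pev ζ (P i)| ≤ X ^ (-η)}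

/-- The uniform exponent ŵ_{n,j}(ζ). -/
noncomputable def whExpJ (n j : ℕ) (ζ : ℝ) : ℝ := sSup (whSetJ n j ζ)

/-- Set of exponents η such that for arbitrarily large X the simultaneous approximation
    system has at least j linearly independent integer vector solutions. -/
def lamSetJ (n j : ℕ) (ζ : ℝ) : Set ℝ :=
  {η | ∀ X₀ : ℝ, ∃ X : ℝ, X₀ ≤ X ∧ ∃ v : Fin j → (Fin (n + 1) → ℤ),
    LinearIndependent ℤ v ∧ ∀ i : Fin j,
      ((|v i 0| : ℤ) : ℝ) ≤ X ∧
      ∀ t : Fin n, |ζ ^ ((t : ℕ) + 1) * ((v i 0 : ℤ) : ℝ) - ((v i t.succ : ℤ) : ℝ)| ≤ X ^ (-η)}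

/-- The exponent λ_{n,j}(ζ). -/
noncomputable def lamExpJ (n j : ℕ) (ζ : ℝ) : ℝ := sSup (lamSetJ n j ζ)

/-- Set of exponents η such that for all sufficiently large X the simultaneous approximation
    system has at least j linearly independent integer vector solutions. -/
def lamhSetJ (n j : ℕ) (ζ : ℝ) : Set ℝ :=
  {η | ∃ X₀ : ℝ, ∀ X : ℝ, X₀ ≤ X → ∃ v : Fin j → (Fin (n + 1) → ℤ),
    LinearIndependent ℤ v ∧ ∀ i : Fin j,
      ((|v i 0| : ℤ) : ℝ) ≤ X ∧
      ∀ t : Fin n, |ζ ^ ((t : ℕ) + 1) * ((v i 0 : ℤ) : ℝ) - ((v i t.succ : ℤ) : ℝ)| ≤ X ^ (-η)}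

/-- The uniform exponent λ̂_{n,j}(ζ). -/
noncomputable def lamhExpJ (n j : ℕ) (ζ : ℝ) : ℝ := sSup (lamhSetJ n j ζ)

/-- An extremal number: a real transcendental number with ŵ₂(ζ) = (3+√5)/2. -/
def IsExtremal (ζ : ℝ) : Prop :=
  Transcendental ℚ ζ ∧ whExp 2 ζ = (3 + Real.sqrt 5) / 2


/-- Value at `ζ` of the polynomial of degree at most two with coefficient vector `v`. -/
noncomputable def quadVal (ζ : ℝ) (v : Fin 3 → ℤ) : ℝ := v 0 + v 1 * ζ + v 2 * ζ ^ 2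

lemma aeval_int_ne_zero_of_transcendental {ζ : ℝ} (hζ : Transcendental ℚ ζ) {P : ℤ[X]}
    (hP : P ≠ 0) : aeval ζ P ≠ 0 := by
  have h : Transcendental ℤ ζ := fun h => hζ ((IsFractionRing.isAlgebraic_iff ℤ ℚ ℝ).1 h)
  exact fun h0 => hP ((transcendental_iff.1 h) P h0)

/-- The polynomial of degree at most two with coefficient vector `v`. -/
noncomputable def quadPoly (v : Fin 3 → ℤ) : ℤ[X] := C (v 0) + C (v 1) * X + C (v 2) * X ^ 2

lemma coeff_quadPoly (v : Fin 3 → ℤ) (i : Fin 3) : (quadPoly v).coeff i = v i := by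
  fin_cases i <;> simp [quadPoly, coeff_X, coeff_C, -eq_intCast]

lemma natDegree_quadPoly_le (v : Fin 3 → ℤ) : (quadPoly v).natDegree ≤ 2 := by
  unfold quadPoly
  compute_degree

lemma quadPoly_ne_zero {v : Fin 3 → ℤ} (hv : v ≠ 0) : quadPoly v ≠ 0 := by
  obtain ⟨i, hi⟩ := Function.ne_iff.1 hv
  intro h
  exact hi (by simpa [h] using (coeff_quadPoly v i).symm)

lemma aeval_quadPoly (ζ : ℝ) (v : Fin 3 → ℤ) : aeval ζ (quadPoly v) = quadVal ζ v := by
  simp [quadPoly, quadVal]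

lemma quadVal_ne_zero {ζ : ℝ} (hζ : Transcendental ℚ ζ) {v : Fin 3 → ℤ} (hv : v ≠ 0) :
    quadVal ζ v ≠ 0 := by
  rw [← aeval_quadPoly]
  exact aeval_int_ne_zero_of_transcendental hζ (quadPoly_ne_zero hv)

open Matrix in
lemma exists_common_factor_of_cross_eq_zero {u v : Fin 3 → ℤ} (hu : u ≠ 0)
    (h : crossProduct u v = 0) : ∃ (g : Fin 3 → ℤ) (p q : ℤ), u = p • g ∧ v = q • g := by
  obtain ⟨i, hi⟩ := Function.ne_iff.1 hu
  have key : ∀ j, u i * v j = u j * v i := by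
    have h0 := congrFun h 0
    have h1 := congrFun h 1
    have h2 := congrFun h 2
    simp [cross_apply] at h0 h1 h2
    intro j
    fin_cases i <;> fin_cases j <;> simp <;> linarith
  obtain ⟨g, p, q, hg, hco, hp, hq⟩ := Int.exists_gcd_one' (m := u i) (n := v i)
    (Int.gcd_pos_of_ne_zero_left _ hi)
  have hg0 : (g : ℤ) ≠ 0 := by exact_mod_cast hg.ne'
  have key2 : ∀ j, p * v j = u j * q := by
    intro j
    have := key j
    rw [hp, hq] at this
    exact mul_left_cancel₀ hg0 (by linear_combination this)
  have hdvd : ∀ j, p ∣ u j := fun j =>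
    (Int.isCoprime_iff_gcd_eq_one.2 hco).dvd_of_dvd_mul_right ⟨v j, (key2 j).symm⟩
  choose G hG using hdvd
  have hp0 : p ≠ 0 := by
    rintro rfl
    simp at hp
    exact hi (by simpa using hp)
  refine ⟨G, p, q, funext fun j => by simp [hG j], funext fun j => ?_⟩
  have := key2 j
  rw [hG j] at this
  exact mul_left_cancel₀ hp0 (by rw [this, Pi.smul_apply, smul_eq_mul]; ring)

lemma exists_minimal_quadVal (ζ : ℝ) {n : ℕ} (hn : 1 ≤ n) :
    ∃ v : Fin 3 → ℤ, (v ≠ 0 ∧ ∀ i, |v i| ≤ n) ∧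
      ∀ u : Fin 3 → ℤ, u ≠ 0 → (∀ i, |u i| ≤ n) → |quadVal ζ v| ≤ |quadVal ζ u| := by
  have hfin : {v : Fin 3 → ℤ | v ≠ 0 ∧ ∀ i, |v i| ≤ n}.Finite := by
    refine (Set.finite_Icc (fun _ : Fin 3 => -(n : ℤ)) (fun _ => (n : ℤ))).subset ?_
    rintro v ⟨-, hv⟩
    exact ⟨fun i => (abs_le.1 (hv i)).1, fun i => (abs_le.1 (hv i)).2⟩
  obtain ⟨v, hv, hmin⟩ := Set.exists_min_image _ (fun v => |quadVal ζ v|) hfin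
    ⟨fun _ => 1, fun h => by simpa using congrFun h 0, fun i => by simpa using hn⟩
  exact ⟨v, hv, fun u h1 h2 => hmin u ⟨h1, h2⟩⟩

lemma exists_minimal_sequence {ζ w : ℝ} (hζ : Transcendental ℚ ζ) (hw : 0 < w)
    (h : ∃ N : ℕ, ∀ n ≥ N, ∃ v : Fin 3 → ℤ, v ≠ 0 ∧ (∀ i, |v i| ≤ n) ∧
      |quadVal ζ v| ≤ (n : ℝ) ^ (-w)) :
    ∃ (v : ℕ → Fin 3 → ℤ) (y : ℕ → ℕ), StrictMono y ∧
      (∀ k i, |v k i| ≤ y k) ∧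
      (∀ k, |quadVal ζ (v k)| ≤ 2 ^ w * (y (k + 1) : ℝ) ^ (-w)) ∧
      (∀ k, |quadVal ζ (v (k + 1))| < |quadVal ζ (v k)|) ∧
      ∀ k, crossProduct (v k) (v (k + 1)) ≠ 0 := by
  obtain ⟨N, hN⟩ := h
  choose! M hM hmin using fun n hn => exists_minimal_quadVal ζ (n := n) hn
  have hbd : ∀ n ≥ N, 1 ≤ n → |quadVal ζ (M n)| ≤ (n : ℝ) ^ (-w) := by
    intro n hn h1
    obtain ⟨v, hv0, hv, hv'⟩ := hN n hn
    exact (hmin n h1 v hv0 hv).trans hv'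
  have hlt : ∀ n, ∃ m, 1 ≤ n → n < m ∧ |quadVal ζ (M m)| < |quadVal ζ (M n)| := by
    intro n
    by_cases h1 : 1 ≤ n
    · have ht : Filter.Tendsto (fun m : ℕ => (m : ℝ) ^ (-w)) Filter.atTop (nhds 0) :=
        (tendsto_rpow_neg_atTop hw).comp tendsto_natCast_atTop_atTop
      have hpos : 0 < |quadVal ζ (M n)| := abs_pos.2 (quadVal_ne_zero hζ (hM n h1).1)
      obtain ⟨m, hm1, hm2⟩ := ((ht.eventually_lt_const hpos).and
        (Filter.eventually_ge_atTop (max N (n + 1)))).exists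
      have := le_of_max_le_left hm2
      have := le_of_max_le_right hm2
      exact ⟨m, fun _ => ⟨by omega, (hbd m (by omega) (by omega)).trans_lt hm1⟩⟩
    · exact ⟨0, fun h => absurd h h1⟩
  let next : ℕ → ℕ := fun n => Nat.find (hlt n)
  have next_spec : ∀ n, 1 ≤ n → n < next n ∧ |quadVal ζ (M (next n))| < |quadVal ζ (M n)| :=
    fun n hn => Nat.find_spec (hlt n) hn
  have next_min : ∀ n, 1 ≤ n → |quadVal ζ (M n)| ≤ |quadVal ζ (M (next n - 1))| := by
    intro n hn
    by_contra! hc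
    have hne : n ≠ next n - 1 := by
      intro h
      rw [← h] at hc
      exact lt_irrefl _ hc
    have := (next_spec n hn).1
    exact Nat.find_min (hlt n) (m := next n - 1) (by change next n - 1 < next n; omega)
      fun _ => ⟨by omega, hc⟩
  let y : ℕ → ℕ := fun k => next^[k] (N + 1)
  have hy : ∀ k, y (k + 1) = next (y k) := fun k => Function.iterate_succ_apply' _ _ _
  have hyN : ∀ k, N + 1 ≤ y k := by
    intro k
    induction k with
    | zero => exact le_rfl
    | succ k ih =>
      rw [hy]
      exact ih.trans (next_spec _ (by omega)).1.le
  have hy1 : ∀ k, 1 ≤ y k := fun k => by have := hyN k; omega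
  have hdec : ∀ k, |quadVal ζ (M (y (k + 1)))| < |quadVal ζ (M (y k))| := fun k => by
    rw [hy]
    exact (next_spec _ (hy1 k)).2
  have hmono : ∀ k, y k < y (k + 1) := fun k => by
    rw [hy]
    exact (next_spec _ (hy1 k)).1
  refine ⟨fun k => M (y k), y, strictMono_nat_of_lt_succ hmono,
    fun k => (hM _ (hy1 k)).2, fun k => ?_, hdec, fun k hk => ?_⟩
  · have h1 := next_min _ (hy1 k)
    rw [← hy] at h1
    have h2 := hmono k
    have h3 := hyN k
    refine (h1.trans (hbd _ (by omega) (by omega))).trans ?_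
    have h4 : (y (k + 1) : ℝ) / 2 ≤ ((y (k + 1) - 1 : ℕ) : ℝ) := by
      have : (2 : ℝ) ≤ y (k + 1) := by exact_mod_cast (by omega : 2 ≤ y (k + 1))
      rw [Nat.cast_sub (by omega)]
      push_cast
      linarith
    have h5 : (0 : ℝ) < y (k + 1) := by exact_mod_cast hy1 (k + 1)
    calc ((y (k + 1) - 1 : ℕ) : ℝ) ^ (-w) ≤ ((y (k + 1) : ℝ) / 2) ^ (-w) :=
          Real.rpow_le_rpow_of_nonpos (by positivity) h4 (by linarith)
      _ = 2 ^ w * (y (k + 1) : ℝ) ^ (-w) := by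
          rw [Real.div_rpow h5.le (by norm_num), Real.rpow_neg (by norm_num : (0 : ℝ) ≤ 2),
            div_inv_eq_mul, mul_comm]
  · obtain ⟨g, p, q, hp, hq⟩ := exists_common_factor_of_cross_eq_zero (hM _ (hy1 k)).1 hk
    replace hq : M (y (k + 1)) = q • g := hq
    have hval : ∀ c : ℤ, quadVal ζ (c • g) = c * quadVal ζ g := fun c => by
      simp [quadVal]
      ring
    have hp0 : p ≠ 0 := by
      rintro rfl
      exact (hM _ (hy1 k)).1 (by rw [hp]; simp)
    have hq0 : q ≠ 0 := by
      rintro rfl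
      exact (hM _ (hy1 (k + 1))).1 (by rw [hq]; simp)
    have hg0 : g ≠ 0 := by
      rintro rfl
      exact (hM _ (hy1 k)).1 (by rw [hp]; simp)
    have h1 : |quadVal ζ (M (y k))| ≤ |quadVal ζ g| := by
      refine hmin _ (hy1 k) g hg0 fun i => le_trans ?_ ((hM _ (hy1 k)).2 i)
      rw [hp, Pi.smul_apply, smul_eq_mul, abs_mul]
      exact le_mul_of_one_le_left (abs_nonneg _) (Int.one_le_abs hp0)
    have h2 : |quadVal ζ g| ≤ |quadVal ζ (M (y (k + 1)))| := by
      rw [hq, hval, abs_mul]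
      exact le_mul_of_one_le_left (abs_nonneg _) (by exact_mod_cast Int.one_le_abs hq0)
    exact absurd (hdec k) (not_lt.2 (h1.trans h2))

open Matrix in
lemma dotProduct_cross_eq (s q r : Fin 3 → ℤ) : s ⬝ᵥ crossProduct q r =
    s 0 * (q 1 * r 2 - q 2 * r 1) + s 1 * (q 2 * r 0 - q 0 * r 2) +
      s 2 * (q 0 * r 1 - q 1 * r 0) := by
  simp [cross_apply, dotProduct, Fin.sum_univ_three]

lemma cross_eq_zero_trans {u v w : Fin 3 → ℤ} (hv : v ≠ 0) (huv : crossProduct u v = 0)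
    (hvw : crossProduct v w = 0) : crossProduct u w = 0 := by
  obtain ⟨g, p, q, rfl, rfl⟩ := exists_common_factor_of_cross_eq_zero hv hvw
  rw [map_smul] at huv ⊢
  rcases smul_eq_zero.1 huv with rfl | h
  · simp at hv
  · rw [h, smul_zero]

open Matrix in
lemma exists_triple_ne_zero {ζ w : ℝ} (hζ : Transcendental ℚ ζ) (hw : 1 < w)
    {v : ℕ → Fin 3 → ℤ} {y : ℕ → ℕ} (hy : StrictMono y) (hvy : ∀ k i, |v k i| ≤ y k)
    {K : ℝ} (hval : ∀ k, |quadVal ζ (v k)| ≤ K * (y (k + 1) : ℝ) ^ (-w))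
    (hdec : ∀ k, |quadVal ζ (v (k + 1))| < |quadVal ζ (v k)|)
    (hcross : ∀ k, crossProduct (v k) (v (k + 1)) ≠ 0) (N : ℕ) :
    ∃ k ≥ N, v k ⬝ᵥ crossProduct (v (k + 1)) (v (k + 2)) ≠ 0 := by
  by_contra! hc
  set m : ℕ → Fin 3 → ℤ := fun k => crossProduct (v k) (v (k + 1)) with hm
  have hstep : ∀ k ≥ N, crossProduct (m k) (m (k + 1)) = 0 := by
    intro k hk
    have hdet := hc k hk
    rw [dotProduct_cross_eq] at hdet
    ext i
    fin_cases i
    · simp [hm, cross_apply]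
      linear_combination (v (k + 1) 0) * hdet
    · simp [hm, cross_apply]
      linear_combination (v (k + 1) 1) * hdet
    · simp [hm, cross_apply]
      linear_combination (v (k + 1) 2) * hdet
  have hpar : ∀ k ≥ N, crossProduct (m N) (m k) = 0 := by
    intro k hk
    induction k, hk using Nat.le_induction with
    | base => exact cross_self _
    | succ k hk ih => exact cross_eq_zero_trans (hcross k) ih (hstep k hk)
  set U : ℝ := ∑ i, |(m N i : ℝ)| with hU
  have hU0 : 0 ≤ U := Finset.sum_nonneg fun _ _ => abs_nonneg _
  have hbound : ∀ k ≥ N, |ζ * m N 0 - m N 1| ≤ U * (2 * K * (y (k + 1) : ℝ) ^ (1 - w)) ∧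
      |ζ ^ 2 * m N 1 - ζ * m N 2| ≤ U * (2 * K * (y (k + 1) : ℝ) ^ (1 - w)) := by
    intro k hk
    obtain ⟨g, p, q, hp, hq⟩ := exists_common_factor_of_cross_eq_zero (hcross N) (hpar k hk)
    replace hp : m N = p • g := hp
    have hq0 : q ≠ 0 := by
      rintro rfl
      exact hcross k (by simpa using hq)
    have hg0 : g ≠ 0 := by
      rintro rfl
      exact hcross k (by simpa using hq)
    have hpU : |(p : ℝ)| ≤ U := by
      obtain ⟨i, hi⟩ := Function.ne_iff.1 hg0
      refine le_trans ?_ (Finset.single_le_sum (f := fun i => |(m N i : ℝ)|)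
        (fun _ _ => abs_nonneg _) (Finset.mem_univ i))
      rw [hp, Pi.smul_apply, smul_eq_mul]
      push_cast
      rw [abs_mul]
      exact le_mul_of_one_le_right (abs_nonneg _) (by exact_mod_cast Int.one_le_abs hi)
    have hy0 : (0 : ℝ) < y (k + 1) := by
      exact_mod_cast (Nat.zero_le _).trans_lt (hy (Nat.lt_succ_self k))
    have hA := hval k
    have hB := (hdec k).le.trans hA
    have hva : ∀ i, |(v k i : ℝ)| ≤ y (k + 1) := fun i =>
      by
      exact_mod_cast (hvy k i).trans (by exact_mod_cast (hy (Nat.lt_succ_self k)).le)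
    have hvb : ∀ i, |(v (k + 1) i : ℝ)| ≤ y (k + 1) := fun i => by exact_mod_cast hvy (k + 1) i
    have hcomb : ∀ i, |v (k + 1) i * quadVal ζ (v k) - v k i * quadVal ζ (v (k + 1))| ≤
        2 * K * (y (k + 1) : ℝ) ^ (1 - w) := by
      intro i
      have e : 2 * K * (y (k + 1) : ℝ) ^ (1 - w) = y (k + 1) * (K * (y (k + 1) : ℝ) ^ (-w)) +
          y (k + 1) * (K * (y (k + 1) : ℝ) ^ (-w)) := by
        rw [sub_eq_add_neg, Real.rpow_add hy0, Real.rpow_one]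
        ring
      rw [e]
      refine (abs_sub _ _).trans (add_le_add ?_ ?_)
      · rw [abs_mul]
        exact mul_le_mul (hvb i) hA (abs_nonneg _) hy0.le
      · rw [abs_mul]
        exact mul_le_mul (hva i) hB (abs_nonneg _) hy0.le
    have hfin : ∀ s t : ℝ, t = q * s → |t| ≤ 2 * K * (y (k + 1) : ℝ) ^ (1 - w) →
        |p * s| ≤ U * (2 * K * (y (k + 1) : ℝ) ^ (1 - w)) := by
      intro s t hst ht
      rw [abs_mul]
      refine mul_le_mul hpU (le_trans ?_ ht) (abs_nonneg _) hU0
      rw [hst, abs_mul]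
      exact le_mul_of_one_le_left (abs_nonneg _) (by exact_mod_cast Int.one_le_abs hq0)
    have hqi : ∀ i, (m k i : ℝ) = q * g i := fun i => by
      have := congrFun hq i
      rw [Pi.smul_apply, smul_eq_mul] at this
      exact_mod_cast this
    have hm0 : (m k 0 : ℝ) = v k 1 * v (k + 1) 2 - v k 2 * v (k + 1) 1 := by
      simp [hm, cross_apply]
    have hm1 : (m k 1 : ℝ) = v k 2 * v (k + 1) 0 - v k 0 * v (k + 1) 2 := by
      simp [hm, cross_apply]
    have hm2 : (m k 2 : ℝ) = v k 0 * v (k + 1) 1 - v k 1 * v (k + 1) 0 := by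
      simp [hm, cross_apply]
    rw [hqi] at hm0 hm1 hm2
    constructor
    · convert hfin (ζ * g 0 - g 1) _ ?_ (hcomb 2) using 2
      · rw [hp]
        simp
        ring
      · rw [quadVal, quadVal]
        linear_combination hm1 - ζ * hm0
    · convert hfin (ζ ^ 2 * g 1 - ζ * g 2) _ ?_ (hcomb 0) using 2
      · rw [hp]
        simp
        ring
      · rw [quadVal, quadVal]
        linear_combination ζ * hm2 - ζ ^ 2 * hm1
  have hlim : Filter.Tendsto (fun k => U * (2 * K * (y (k + 1) : ℝ) ^ (1 - w))) Filter.atTop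
      (nhds 0) := by
    have h1 : Filter.Tendsto (fun k => (y (k + 1) : ℝ)) Filter.atTop Filter.atTop :=
      tendsto_natCast_atTop_atTop.comp (hy.tendsto_atTop.comp (Filter.tendsto_add_atTop_nat 1))
    have h2 := (tendsto_rpow_neg_atTop (sub_pos.2 hw)).comp h1
    have h3 := (h2.const_mul (2 * K)).const_mul U
    simpa using h3
  have hz : ∀ t : ℝ, (∀ k ≥ N, |t| ≤ U * (2 * K * (y (k + 1) : ℝ) ^ (1 - w))) → t = 0 :=
    fun t ht => abs_nonpos_iff.1 (ge_of_tendsto hlim (Filter.eventually_atTop.2 ⟨N, ht⟩))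
  have e1 := hz _ fun k hk => (hbound k hk).1
  have e2 := hz _ fun k hk => (hbound k hk).2
  have f1 : (![-m N 1, m N 0, 0] : Fin 3 → ℤ) = 0 := by
    by_contra h
    exact quadVal_ne_zero hζ h (by simp [quadVal]; linarith)
  have f2 : (![0, -m N 2, m N 1] : Fin 3 → ℤ) = 0 := by
    by_contra h
    exact quadVal_ne_zero hζ h (by simp [quadVal]; linarith)
  have g0 := congrFun f1 1
  have g1 := congrFun f1 0
  have g2 := congrFun f2 1
  simp at g0 g1 g2
  exact hcross N (by ext i; fin_cases i; exacts [g0, g1, g2])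

lemma abs_det_two_le {a b c d A B : ℝ} (ha : |a| ≤ A) (hb : |b| ≤ A) (hc : |c| ≤ B)
    (hd : |d| ≤ B) : |a * d - b * c| ≤ 2 * (A * B) := by
  have hA := (abs_nonneg a).trans ha
  refine (abs_sub _ _).trans ?_
  rw [abs_mul, abs_mul, two_mul]
  exact add_le_add (mul_le_mul ha hd (abs_nonneg _) hA) (mul_le_mul hb hc (abs_nonneg _) hA)

lemma abs_det_three_le {a b c : Fin 3 → ℝ} {A B D : ℝ} (ha : ∀ i, |a i| ≤ A)
    (hb : ∀ i, |b i| ≤ B) (hc : ∀ i, |c i| ≤ D) :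
    |a 0 * (b 1 * c 2 - b 2 * c 1) - a 1 * (b 0 * c 2 - b 2 * c 0) +
      a 2 * (b 0 * c 1 - b 1 * c 0)| ≤ 6 * (A * B * D) := by
  have hA := (abs_nonneg _).trans (ha 0)
  have h : ∀ i j k, |a i * (b j * c k - b k * c j)| ≤ A * (2 * (B * D)) := fun i j k => by
    rw [abs_mul]
    exact mul_le_mul (ha i) (abs_det_two_le (hb j) (hb k) (hc j) (hc k)) (abs_nonneg _) hA
  have h1 := abs_le.1 (h 0 1 2)
  have h2 := abs_le.1 (h 1 0 2)
  have h3 := abs_le.1 (h 2 0 1)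
  rw [abs_le]
  constructor <;> linarith [h1.1, h1.2, h2.1, h2.2, h3.1, h3.2]

/-- Coefficient bounds and small values at `ζ` for three independent integer polynomials of degree
at most two, the last two being consecutive minimal ones. -/
structure IsMinimalTriple (ζ w K Y Z : ℝ) (s q r : Fin 3 → ℤ) : Prop where
  one_le : 1 ≤ Y
  le : Y ≤ Z
  abs_s_le : ∀ i, |(s i : ℝ)| ≤ Y
  abs_q_le : ∀ i, |(q i : ℝ)| ≤ Y
  abs_r_le : ∀ i, |(r i : ℝ)| ≤ Z
  val_s_le : |quadVal ζ s| ≤ K * Y ^ (-w)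
  val_q_le : |quadVal ζ q| ≤ K * Z ^ (-w)
  val_r_le : |quadVal ζ r| ≤ K * Z ^ (-w)
  det_ne_zero : s ⬝ᵥ crossProduct q r ≠ 0

lemma IsMinimalTriple.one_le_mul {ζ w K Y Z : ℝ} {s q r : Fin 3 → ℤ}
    (h : IsMinimalTriple ζ w K Y Z s q r) (hw : 1 ≤ w) (hK : 0 ≤ K) :
    1 ≤ 6 * (K * Y ^ (-w) * Y * Z) := by
  have hdet := h.det_ne_zero
  have hY := h.one_le
  have hYZ := h.le
  rw [dotProduct_cross_eq] at hdet
  have h1 : (1 : ℝ) ≤ |(s 0 * (q 1 * r 2 - q 2 * r 1) + s 1 * (q 2 * r 0 - q 0 * r 2) +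
      s 2 * (q 0 * r 1 - q 1 * r 0) : ℝ)| := by exact_mod_cast Int.one_le_abs hdet
  have e : (s 0 * (q 1 * r 2 - q 2 * r 1) + s 1 * (q 2 * r 0 - q 0 * r 2) +
      s 2 * (q 0 * r 1 - q 1 * r 0) : ℝ) =
      quadVal ζ s * (q 1 * r 2 - q 2 * r 1) - quadVal ζ q * (s 1 * r 2 - s 2 * r 1) +
        quadVal ζ r * (s 1 * q 2 - s 2 * q 1) := by
    simp only [quadVal]
    ring
  have hmono : K * Z ^ (-w) ≤ K * Y ^ (-w) :=
    mul_le_mul_of_nonneg_left (Real.rpow_le_rpow_of_nonpos (by linarith) hYZ (by linarith)) hK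
  have hKY : 0 ≤ K * Y ^ (-w) := by positivity
  have d1 := abs_det_two_le (h.abs_q_le 1) (h.abs_q_le 2) (h.abs_r_le 1) (h.abs_r_le 2)
  have d2 := abs_det_two_le (h.abs_s_le 1) (h.abs_s_le 2) (h.abs_r_le 1) (h.abs_r_le 2)
  have d3 : |(s 1 * q 2 - s 2 * q 1 : ℝ)| ≤ 2 * (Y * Z) :=
    (abs_det_two_le (h.abs_s_le 1) (h.abs_s_le 2) (h.abs_q_le 1) (h.abs_q_le 2)).trans (by gcongr)
  have t1 := mul_le_mul h.val_s_le d1 (abs_nonneg _) hKY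
  have t2 := mul_le_mul (h.val_q_le.trans hmono) d2 (abs_nonneg _) hKY
  have t3 := mul_le_mul (h.val_r_le.trans hmono) d3 (abs_nonneg _) hKY
  rw [← abs_mul] at t1 t2 t3
  rw [e] at h1
  have := (abs_add_le (quadVal ζ s * (q 1 * r 2 - q 2 * r 1) -
    quadVal ζ q * (s 1 * r 2 - s 2 * r 1)) (quadVal ζ r * (s 1 * q 2 - s 2 * q 1)))
  have := abs_sub (quadVal ζ s * (q 1 * r 2 - q 2 * r 1 : ℝ))
    (quadVal ζ q * (s 1 * r 2 - s 2 * r 1))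
  linarith

/-- Gelfond's inequality for a product of two linear polynomials. -/
lemma abs_mul_coeff_le_of_linear_mul {u v a b M : ℝ} (h0 : |u * a| ≤ M) (h1 : |u * b + v * a| ≤ M)
    (h2 : |v * b| ≤ M) : |u * b| ≤ 2 * M := by
  by_contra! hc
  have hM := (abs_nonneg _).trans h0
  have h3 : |u * b| ≤ M + |v * a| := by
    have := abs_sub (u * b + v * a) (v * a)
    rw [add_sub_cancel_right] at this
    linarith
  have h4 : |u * b| * |v * a| ≤ M * M := by
    have := mul_le_mul h0 h2 (abs_nonneg _) hM
    calc |u * b| * |v * a| = |u * a| * |v * b| := by simp only [abs_mul]; ring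
      _ ≤ M * M := this
  nlinarith

lemma IsMinimalTriple.one_le_of_common_factor {ζ w K Y Z : ℝ} {s q r : Fin 3 → ℤ}
    (h : IsMinimalTriple ζ w K Y Z s q r) (hw : 1 ≤ w) (hK : 0 ≤ K) {u v a₀ a₁ b₀ b₁ : ℤ}
    (hq0 : q 0 = u * a₀) (hq1 : q 1 = u * a₁ + v * a₀) (hq2 : q 2 = v * a₁)
    (hr0 : r 0 = u * b₀) (hr1 : r 1 = u * b₁ + v * b₀) (hr2 : r 2 = v * b₁) :
    1 ≤ (12 + 4 * |ζ|) * (K * Y ^ (-w) * Y ^ 2) := by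
  have hY := h.one_le
  have hYZ := h.le
  have hdet : (v ^ 2 * s 0 - u * v * s 1 + u ^ 2 * s 2) * (a₀ * b₁ - a₁ * b₀) ≠ 0 := by
    have := h.det_ne_zero
    rw [dotProduct_cross_eq, hq0, hq1, hq2, hr0, hr1, hr2] at this
    intro h0
    apply this
    linear_combination h0
  have hD : (1 : ℝ) ≤ |(a₀ * b₁ - a₁ * b₀ : ℝ)| := by
    exact_mod_cast Int.one_le_abs (right_ne_zero_of_mul hdet)
  have hR : (1 : ℝ) ≤ |(v ^ 2 * s 0 - u * v * s 1 + u ^ 2 * s 2 : ℝ)| := by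
    exact_mod_cast Int.one_le_abs (left_ne_zero_of_mul hdet)
  have hq := h.abs_q_le
  have hr := h.abs_r_le
  have q0 := hq 0
  have q1 := hq 1
  have q2 := hq 2
  have r0 := hr 0
  have r1 := hr 1
  have r2 := hr 2
  rw [hq0] at q0
  rw [hq1] at q1
  rw [hq2] at q2
  rw [hr0] at r0
  rw [hr1] at r1
  rw [hr2] at r2
  push_cast at q0 q1 q2 r0 r1 r2
  have ua1 := abs_mul_coeff_le_of_linear_mul q0 q1 q2
  have va0 := abs_mul_coeff_le_of_linear_mul q2 (by rwa [add_comm]) q0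
  have ub1 := abs_mul_coeff_le_of_linear_mul r0 r1 r2
  have va1 : |(v * a₁ : ℝ)| ≤ 2 * Y := by linarith
  have ua0 : |(u * a₀ : ℝ)| ≤ 2 * Y := by linarith
  have vb1 : |(v * b₁ : ℝ)| ≤ 2 * Z := by linarith
  have hle : ∀ x : ℤ, |(x * a₀ : ℝ)| ≤ 2 * Y → |(x * a₁ : ℝ)| ≤ 2 * Y → |(x : ℝ)| ≤ 2 * Y := by
    intro x h0 h1
    by_cases ha : a₀ = 0
    · have ha1 : a₁ ≠ 0 := by
        rintro rfl
        apply right_ne_zero_of_mul hdet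
        rw [ha]
        ring
      rw [abs_mul] at h1
      exact (le_mul_of_one_le_right (abs_nonneg _) (by exact_mod_cast Int.one_le_abs ha1)).trans h1
    · rw [abs_mul] at h0
      exact (le_mul_of_one_le_right (abs_nonneg _) (by exact_mod_cast Int.one_le_abs ha)).trans h0
  have hu := hle u ua0 ua1
  have hv := hle v va0 va1
  have hKZ : 0 ≤ K * Z ^ (-w) := mul_nonneg hK (Real.rpow_nonneg (by linarith) _)
  have hZl : ∀ x : ℤ, |(x * a₁ : ℝ)| ≤ 2 * Y → |(x * b₁ : ℝ)| ≤ 2 * Z →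
      |x * (u + v * ζ)| ≤ 4 * (K * Z ^ (-w) * Z) := by
    intro x h0 h1
    have e : x * (u + v * ζ) * (a₀ * b₁ - a₁ * b₀) =
        quadVal ζ q * (x * b₁) - quadVal ζ r * (x * a₁) := by
      rw [quadVal, quadVal, hq0, hq1, hq2, hr0, hr1, hr2]
      push_cast
      ring
    have t1 := mul_le_mul h.val_q_le h1 (abs_nonneg _) hKZ
    have t2 := mul_le_mul h.val_r_le (h0.trans (by linarith : 2 * Y ≤ 2 * Z)) (abs_nonneg _) hKZ
    rw [← abs_mul] at t1 t2
    calc |x * (u + v * ζ)| ≤ |x * (u + v * ζ)| * |(a₀ * b₁ - a₁ * b₀ : ℝ)| :=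
          le_mul_of_one_le_right (abs_nonneg _) hD
      _ = |quadVal ζ q * (x * b₁) - quadVal ζ r * (x * a₁)| := by rw [← abs_mul, e]
      _ ≤ _ := (abs_sub _ _).trans (by linarith)
  have hmono : K * Z ^ (-w) * Z ≤ K * Y ^ (-w) * Y := by
    have e : ∀ t : ℝ, 1 ≤ t → K * t ^ (-w) * t = K * t ^ (1 - w) := fun t ht => by
      rw [mul_assoc, ← Real.rpow_add_one (by linarith)]
      ring_nf
    rw [e _ hY, e _ (hY.trans hYZ)]
    exact mul_le_mul_of_nonneg_left
      (Real.rpow_le_rpow_of_nonpos (by linarith) hYZ (by linarith)) hK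
  have hul := (hZl u ua1 ub1).trans (mul_le_mul_of_nonneg_left hmono (by norm_num))
  have hvl := (hZl v va1 vb1).trans (mul_le_mul_of_nonneg_left hmono (by norm_num))
  have e : (v ^ 2 * s 0 - u * v * s 1 + u ^ 2 * s 2 : ℝ) = v * v * quadVal ζ s +
      u * (u + v * ζ) * s 2 - v * (u + v * ζ) * s 2 * ζ - v * (u + v * ζ) * s 1 := by
    rw [quadVal]
    ring
  set T := K * Y ^ (-w) with hT
  have hT0 : 0 ≤ T := by positivity
  have t0 : |v * v * quadVal ζ s| ≤ 2 * Y * (2 * Y) * T := by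
    rw [abs_mul, abs_mul]
    have := h.val_s_le
    gcongr
  have t1 : |u * (u + v * ζ) * s 2| ≤ 4 * (T * Y) * Y := by
    rw [abs_mul]
    exact mul_le_mul hul (h.abs_s_le 2) (abs_nonneg _) (by positivity)
  have t2 : |v * (u + v * ζ) * s 2 * ζ| ≤ 4 * (T * Y) * Y * |ζ| := by
    rw [abs_mul, abs_mul _ (s 2 : ℝ)]
    exact mul_le_mul_of_nonneg_right
      (mul_le_mul hvl (h.abs_s_le 2) (abs_nonneg _) (by positivity)) (abs_nonneg _)
  have t3 : |v * (u + v * ζ) * s 1| ≤ 4 * (T * Y) * Y := by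
    rw [abs_mul]
    exact mul_le_mul hvl (h.abs_s_le 1) (abs_nonneg _) (by positivity)
  rw [e] at hR
  have i1 := abs_sub (v * v * quadVal ζ s +
      u * (u + v * ζ) * s 2 - v * (u + v * ζ) * s 2 * ζ) (v * (u + v * ζ) * s 1)
  have i2 := abs_sub (v * v * quadVal ζ s +
      u * (u + v * ζ) * s 2) (v * (u + v * ζ) * s 2 * ζ)
  have i3 := abs_add_le (v * v * quadVal ζ s) (u * (u + v * ζ) * s 2)
  linarith

lemma IsMinimalTriple.q_ne_zero {ζ w K Y Z : ℝ} {s q r : Fin 3 → ℤ}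
    (h : IsMinimalTriple ζ w K Y Z s q r) : q ≠ 0 := by
  rintro rfl
  exact h.det_ne_zero (by simp)

lemma IsMinimalTriple.r_ne_zero {ζ w K Y Z : ℝ} {s q r : Fin 3 → ℤ}
    (h : IsMinimalTriple ζ w K Y Z s q r) : r ≠ 0 := by
  rintro rfl
  exact h.det_ne_zero (by simp)

lemma IsMinimalTriple.mul_quadPoly_ne {ζ w K Y Z : ℝ} {s q r : Fin 3 → ℤ}
    (h : IsMinimalTriple ζ w K Y Z s q r) (hw : 1 ≤ w) (hK : 0 ≤ K)
    (hsmall : (12 + 4 * |ζ|) * (K * Y ^ (-w) * Y ^ 2) < 1) {A B : ℤ[X]} (hA : A.natDegree ≤ 1)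
    (hB : B.natDegree ≤ 1) (hB0 : B ≠ 0) : A * quadPoly q ≠ B * quadPoly r := by
  intro hAB
  have hq0 := quadPoly_ne_zero h.q_ne_zero
  have hr0 := quadPoly_ne_zero h.r_ne_zero
  obtain ⟨a, b, l, hrel, hla, hlb⟩ :=
    UniqueFactorizationMonoid.exists_reduced_factors (quadPoly q) hq0 (quadPoly r)
  have hl0 : l ≠ 0 := left_ne_zero_of_mul (hla.trans_ne hq0)
  have ha0 : a ≠ 0 := right_ne_zero_of_mul (hla.trans_ne hq0)
  have hb0 : b ≠ 0 := right_ne_zero_of_mul (hlb.trans_ne hr0)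
  have hA0 : A ≠ 0 := by
    rintro rfl
    rw [zero_mul] at hAB
    exact mul_ne_zero hB0 hr0 hAB.symm
  have hab : A * a = B * b := mul_left_cancel₀ hl0 (by
    rw [← hla, ← hlb] at hAB
    linear_combination hAB)
  have ha : a.natDegree ≤ 1 := (natDegree_le_of_dvd
    (hrel.dvd_of_dvd_mul_right ⟨A, by rw [← hab, mul_comm]⟩) hB0).trans hB
  have hb : b.natDegree ≤ 1 := (natDegree_le_of_dvd
    (hrel.symm.dvd_of_dvd_mul_right ⟨B, by rw [hab, mul_comm]⟩) hA0).trans hA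
  have hla2 : l.natDegree + a.natDegree ≤ 2 := by
    rw [← natDegree_mul hl0 ha0, hla]
    exact natDegree_quadPoly_le q
  have hlb2 : l.natDegree + b.natDegree ≤ 2 := by
    rw [← natDegree_mul hl0 hb0, hlb]
    exact natDegree_quadPoly_le r
  have hl : l.natDegree ≤ 1 := by
    by_contra hl
    rw [eq_C_of_natDegree_eq_zero (by omega : a.natDegree = 0)] at hla
    rw [eq_C_of_natDegree_eq_zero (by omega : b.natDegree = 0)] at hlb
    apply h.det_ne_zero
    rw [dotProduct_cross_eq]
    simp_rw [← coeff_quadPoly q, ← coeff_quadPoly r, ← hla, ← hlb, coeff_mul_C]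
    ring
  have hcoeff : ∀ x : ℤ[X], x.natDegree ≤ 1 → ∀ v : Fin 3 → ℤ, l * x = quadPoly v →
      v 0 = l.coeff 0 * x.coeff 0 ∧ v 1 = l.coeff 0 * x.coeff 1 + l.coeff 1 * x.coeff 0 ∧
        v 2 = l.coeff 1 * x.coeff 1 := by
    intro x hx v hv
    have hl2 : l.coeff 2 = 0 := coeff_eq_zero_of_natDegree_lt (by omega)
    have hx2 : x.coeff 2 = 0 := coeff_eq_zero_of_natDegree_lt (by omega)
    rw [← coeff_quadPoly v 0, ← coeff_quadPoly v 1, ← coeff_quadPoly v 2, ← hv]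
    simp [coeff_mul, Finset.Nat.antidiagonal_succ, hl2, hx2]
  obtain ⟨e0, e1, e2⟩ := hcoeff a ha q hla
  obtain ⟨f0, f1, f2⟩ := hcoeff b hb r hlb
  exact absurd (h.one_le_of_common_factor hw hK e0 e1 e2 f0 f1 f2) (not_le.2 hsmall)

lemma abs_det_four_le {a b c d : Fin 4 → ℤ} {A B D E : ℝ} (ha : ∀ i, |(a i : ℝ)| ≤ A)
    (hb : ∀ i, |(b i : ℝ)| ≤ B) (hc : ∀ i, |(c i : ℝ)| ≤ D) (hd : ∀ i, |(d i : ℝ)| ≤ E) (ζ : ℝ) :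
    |((Matrix.of ![a, b, c, d]).det : ℝ)| ≤
      6 * (|∑ i, a i * ζ ^ (i : ℕ)| * (B * D * E) + |∑ i, b i * ζ ^ (i : ℕ)| * (A * D * E) +
        |∑ i, c i * ζ ^ (i : ℕ)| * (A * B * E) + |∑ i, d i * ζ ^ (i : ℕ)| * (A * B * D)) := by
  have key : ∀ {x y z : Fin 4 → ℤ} {F G H : ℝ} (t : ℝ), (∀ i, |(x i : ℝ)| ≤ F) →
      (∀ i, |(y i : ℝ)| ≤ G) → (∀ i, |(z i : ℝ)| ≤ H) →
      |t * (x 1 * (y 2 * z 3 - y 3 * z 2) - x 2 * (y 1 * z 3 - y 3 * z 1) +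
        x 3 * (y 1 * z 2 - y 2 * z 1))| ≤ |t| * (6 * (F * G * H)) := by
    intro x y z F G H t hx hy hz
    rw [abs_mul]
    exact mul_le_mul_of_nonneg_left (abs_det_three_le (a := fun i => x i.succ)
      (b := fun i => y i.succ) (c := fun i => z i.succ) (fun i => hx _) (fun i => hy _)
      (fun i => hz _)) (abs_nonneg _)
  have k1 := key (∑ i, a i * ζ ^ (i : ℕ)) hb hc hd
  have k2 := key (∑ i, b i * ζ ^ (i : ℕ)) ha hc hd
  have k3 := key (∑ i, c i * ζ ^ (i : ℕ)) ha hb hd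
  have k4 := key (∑ i, d i * ζ ^ (i : ℕ)) ha hb hc
  rw [abs_le] at k1 k2 k3 k4
  have e : ((Matrix.of ![a, b, c, d]).det : ℝ) =
      (∑ i, a i * ζ ^ (i : ℕ)) * (b 1 * (c 2 * d 3 - c 3 * d 2) - b 2 * (c 1 * d 3 - c 3 * d 1) +
        b 3 * (c 1 * d 2 - c 2 * d 1)) -
      (∑ i, b i * ζ ^ (i : ℕ)) * (a 1 * (c 2 * d 3 - c 3 * d 2) - a 2 * (c 1 * d 3 - c 3 * d 1) +
        a 3 * (c 1 * d 2 - c 2 * d 1)) +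
      (∑ i, c i * ζ ^ (i : ℕ)) * (a 1 * (b 2 * d 3 - b 3 * d 2) - a 2 * (b 1 * d 3 - b 3 * d 1) +
        a 3 * (b 1 * d 2 - b 2 * d 1)) -
      (∑ i, d i * ζ ^ (i : ℕ)) * (a 1 * (b 2 * c 3 - b 3 * c 2) - a 2 * (b 1 * c 3 - b 3 * c 1) +
        a 3 * (b 1 * c 2 - b 2 * c 1)) := by
    simp [Matrix.det_succ_row_zero, Fin.sum_univ_succ, Fin.succAbove]
    ring
  rw [e, abs_le]
  constructor <;> linarith [k1.1, k1.2, k2.1, k2.2, k3.1, k3.2, k4.1, k4.2]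

/-- A vanishing determinant gives a linear relation between the polynomials in its rows. -/
lemma exists_relation_of_det_eq_zero {a b c d : Fin 4 → ℤ}
    (h : (Matrix.of ![a, b, c, d]).det = 0) : ∃ x : Fin 4 → ℤ, x ≠ 0 ∧
      C (x 0) * ∑ i, C (a i) * X ^ (i : ℕ) + C (x 1) * ∑ i, C (b i) * X ^ (i : ℕ) +
        C (x 2) * ∑ i, C (c i) * X ^ (i : ℕ) + C (x 3) * ∑ i, C (d i) * X ^ (i : ℕ) =
          (0 : ℤ[X]) := by
  obtain ⟨x, hx, hM⟩ := Matrix.exists_vecMul_eq_zero_iff.2 h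
  refine ⟨x, hx, ?_⟩
  have hi : ∀ i, C (x 0) * C (a i) + C (x 1) * C (b i) + C (x 2) * C (c i) + C (x 3) * C (d i) =
      (0 : ℤ[X]) := by
    intro i
    have := congrFun hM i
    simp only [Matrix.vecMul, dotProduct, Fin.sum_univ_four] at this
    rw [← C_mul, ← C_mul, ← C_mul, ← C_mul, ← C_add, ← C_add, ← C_add, ← C_0]
    exact congrArg C this
  rw [Finset.mul_sum, Finset.mul_sum, Finset.mul_sum, Finset.mul_sum, ← Finset.sum_add_distrib,
    ← Finset.sum_add_distrib, ← Finset.sum_add_distrib]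
  exact Finset.sum_eq_zero fun i _ => by linear_combination X ^ (i : ℕ) * hi i

lemma natDegree_linear_le (a b : ℤ) : (C a + C b * X : ℤ[X]).natDegree ≤ 1 := by
  compute_degree

lemma linear_eq_zero {a b : ℤ} (h : (C a + C b * X : ℤ[X]) = 0) : a = 0 ∧ b = 0 := by
  have h0 := congrArg (coeff · 0) h
  have h1 := congrArg (coeff · 1) h
  simp [coeff_C, -eq_intCast] at h0 h1
  exact ⟨h0, h1⟩

lemma IsMinimalTriple.det_ne_zero_or {ζ w K Y Z : ℝ} {s q r : Fin 3 → ℤ}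
    (h : IsMinimalTriple ζ w K Y Z s q r) (hw : 1 ≤ w) (hK : 0 ≤ K)
    (hsmall : (12 + 4 * |ζ|) * (K * Y ^ (-w) * Y ^ 2) < 1) {P : ℤ[X]} (hP : Irreducible P)
    (hdeg : P.natDegree = 3) :
    (Matrix.of ![![q 0, q 1, q 2, 0], ![0, q 0, q 1, q 2], fun i : Fin 4 => P.coeff i,
      ![r 0, r 1, r 2, 0]]).det ≠ 0 ∨
    (Matrix.of ![![q 0, q 1, q 2, 0], ![0, q 0, q 1, q 2], fun i : Fin 4 => P.coeff i,
      ![0, r 0, r 1, r 2]]).det ≠ 0 := by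
  by_contra! hc
  obtain ⟨x, hx, hx'⟩ := exists_relation_of_det_eq_zero hc.1
  obtain ⟨y, hy, hy'⟩ := exists_relation_of_det_eq_zero hc.2
  have hPsum : ∑ i : Fin 4, C (P.coeff i) * X ^ (i : ℕ) = P := by
    conv_rhs => rw [P.as_sum_range_C_mul_X_pow, hdeg]
    exact Fin.sum_univ_eq_sum_range (fun i => C (P.coeff i) * X ^ i) 4
  rw [hPsum] at hx' hy'
  have hx2 : (C (x 0) + C (x 1) * X) * quadPoly q + C (x 2) * P + C (x 3) * quadPoly r = 0 := by
    rw [← hx']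
    simp [Fin.sum_univ_four, quadPoly, -eq_intCast]
    ring
  have hy2 : (C (y 0) + C (y 1) * X) * quadPoly q + C (y 2) * P + C (y 3) * X * quadPoly r = 0 := by
    rw [← hy']
    simp [Fin.sum_univ_four, quadPoly, -eq_intCast]
    ring
  have hq0 := quadPoly_ne_zero h.q_ne_zero
  have hnot : ∀ x : Fin 4 → ℤ, x ≠ 0 →
      (C (x 0) + C (x 1) * X) * quadPoly q + C (x 2) * P = 0 → x 3 ≠ 0 := by
    intro x hx hrel h3
    have hdvd : P ∣ (C (x 0) + C (x 1) * X) * quadPoly q :=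
      ⟨-C (x 2), by linear_combination hrel⟩
    have hlin : (C (x 0) + C (x 1) * X : ℤ[X]) = 0 := by
      by_contra hne
      rcases hP.prime.dvd_or_dvd hdvd with h1 | h1
      · have := natDegree_le_of_dvd h1 hne
        have := natDegree_linear_le (x 0) (x 1)
        omega
      · have := natDegree_le_of_dvd h1 hq0
        have := natDegree_quadPoly_le q
        omega
    obtain ⟨h0, h1⟩ := linear_eq_zero hlin
    rw [hlin, zero_mul, zero_add] at hrel
    have h2 : x 2 = 0 := C_eq_zero.1 ((mul_eq_zero.1 hrel).resolve_right hP.ne_zero)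
    exact hx (by ext i; fin_cases i; exacts [h0, h1, h2, h3])
  have hx3 : x 3 ≠ 0 := fun h3 => hnot x hx (by simpa [h3] using hx2) h3
  have hy3 : y 3 ≠ 0 := fun h3 => hnot y hy (by simpa [h3] using hy2) h3
  by_cases hxy : x 2 = 0
  · refine h.mul_quadPoly_ne hw hK hsmall (A := C (x 0) + C (x 1) * X) (B := C (-x 3))
      (natDegree_linear_le _ _) (by simp) (by simpa using hx3) ?_
    rw [hxy] at hx2
    simp only [C_0, C_neg] at hx2 ⊢
    linear_combination hx2
  · refine h.mul_quadPoly_ne hw hK hsmall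
      (A := C (y 2 * x 0 - x 2 * y 0) + C (y 2 * x 1 - x 2 * y 1) * X)
      (B := C (-(y 2 * x 3)) + C (x 2 * y 3) * X)
      (natDegree_linear_le _ _) (natDegree_linear_le _ _)
      (fun h0 => mul_ne_zero hxy hy3 (linear_eq_zero h0).2) ?_
    simp only [C_sub, C_mul, C_neg]
    linear_combination C (y 2) * hx2 - C (x 2) * hy2

lemma IsMinimalTriple.one_le_of_irreducible {ζ w K Y Z : ℝ} {s q r : Fin 3 → ℤ}
    (h : IsMinimalTriple ζ w K Y Z s q r) (hw : 1 ≤ w) (hK : 0 ≤ K)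
    (hsmall : (12 + 4 * |ζ|) * (K * Y ^ (-w) * Y ^ 2) < 1) {P : ℤ[X]} (hP : Irreducible P)
    (hdeg : P.natDegree = 3) {T : ℝ} (hT : ∀ i, |(P.coeff i : ℝ)| ≤ T) :
    1 ≤ 6 * ((2 + 2 * |ζ|) * (K * Z ^ (-w) * Y * T * Z) + |aeval ζ P| * (Y * Y * Z)) := by
  have hY := h.one_le
  have hYZ := h.le
  have hT0 : 0 ≤ T := (abs_nonneg _).trans (hT 0)
  have hZ0 : 0 ≤ Z := by linarith
  have hKZ : 0 ≤ K * Z ^ (-w) := by positivity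
  have hPval : ∑ i : Fin 4, (P.coeff i : ℝ) * ζ ^ (i : ℕ) = aeval ζ P := by
    rw [aeval_eq_sum_range, hdeg, Fin.sum_univ_eq_sum_range (fun i => (P.coeff i : ℝ) * ζ ^ i) 4]
    simp
  have hbd : ∀ (v : Fin 3 → ℤ) (U : ℝ), (∀ i, |(v i : ℝ)| ≤ U) →
      (∀ i, |((![v 0, v 1, v 2, 0] : Fin 4 → ℤ) i : ℝ)| ≤ U) ∧
      (∀ i, |((![0, v 0, v 1, v 2] : Fin 4 → ℤ) i : ℝ)| ≤ U) := by
    intro v U hv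
    have hU := (abs_nonneg _).trans (hv 0)
    constructor <;> intro i <;> fin_cases i <;> simp [hv, hU]
  have hval : ∀ v : Fin 3 → ℤ,
      ∑ i, ((![v 0, v 1, v 2, 0] : Fin 4 → ℤ) i : ℝ) * ζ ^ (i : ℕ) = quadVal ζ v ∧
      ∑ i, ((![0, v 0, v 1, v 2] : Fin 4 → ℤ) i : ℝ) * ζ ^ (i : ℕ) = ζ * quadVal ζ v := by
    intro v
    constructor
    · simp [Fin.sum_univ_four, quadVal]
    · simp [Fin.sum_univ_four, quadVal]
      ring
  have key : ∀ e : Fin 4 → ℤ, (∀ i, |(e i : ℝ)| ≤ Z) →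
      |∑ i, (e i : ℝ) * ζ ^ (i : ℕ)| ≤ (1 + |ζ|) * (K * Z ^ (-w)) →
      (Matrix.of ![![q 0, q 1, q 2, 0], ![0, q 0, q 1, q 2], fun i : Fin 4 => P.coeff i,
        e]).det ≠ 0 →
      1 ≤ 6 * ((2 + 2 * |ζ|) * (K * Z ^ (-w) * Y * T * Z) + |aeval ζ P| * (Y * Y * Z)) := by
    intro e he heval hdet
    have h1 : (1 : ℝ) ≤ |((Matrix.of ![![q 0, q 1, q 2, 0], ![0, q 0, q 1, q 2],
      fun i : Fin 4 => P.coeff i, e]).det : ℝ)| := by exact_mod_cast Int.one_le_abs hdet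
    have h2 := abs_det_four_le (hbd q Y h.abs_q_le).1 (hbd q Y h.abs_q_le).2
      (c := fun i : Fin 4 => P.coeff i) (fun i => hT i) he ζ
    rw [(hval q).1, (hval q).2, hPval, abs_mul] at h2
    have t1 : |quadVal ζ q| * (Y * T * Z) ≤ K * Z ^ (-w) * (Y * T * Z) :=
      mul_le_mul_of_nonneg_right h.val_q_le (by positivity)
    have t2 : |ζ| * |quadVal ζ q| * (Y * T * Z) ≤ |ζ| * (K * Z ^ (-w)) * (Y * T * Z) :=
      mul_le_mul_of_nonneg_right (mul_le_mul_of_nonneg_left h.val_q_le (abs_nonneg _))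
        (by positivity)
    have t3 : |∑ i, (e i : ℝ) * ζ ^ (i : ℕ)| * (Y * Y * T) ≤
        (1 + |ζ|) * (K * Z ^ (-w)) * (Y * T * Z) := by
      refine mul_le_mul heval ?_ (by positivity) (by positivity)
      calc Y * Y * T = Y * T * Y := by ring
        _ ≤ Y * T * Z := by gcongr
    refine h1.trans (h2.trans ?_)
    linarith
  have hr := h.val_r_le
  rcases h.det_ne_zero_or hw hK hsmall hP hdeg with h0 | h0
  · refine key _ (hbd r Z h.abs_r_le).1 ?_ h0
    rw [(hval r).1]
    have := mul_nonneg (abs_nonneg ζ) hKZ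
    linarith
  · refine key _ (hbd r Z h.abs_r_le).2 ?_ h0
    rw [(hval r).2, abs_mul]
    have := mul_le_mul_of_nonneg_left hr (abs_nonneg ζ)
    linarith

lemma exists_isMinimalTriple {ζ w : ℝ} (hζ : Transcendental ℚ ζ) (hw : 1 < w)
    (h : ∃ N : ℕ, ∀ n ≥ N, ∃ v : Fin 3 → ℤ, v ≠ 0 ∧ (∀ i, |v i| ≤ n) ∧
      |quadVal ζ v| ≤ (n : ℝ) ^ (-w)) (N : ℝ) :
    ∃ Y Z s q r, N ≤ Y ∧ IsMinimalTriple ζ w (2 ^ w) Y Z s q r := by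
  obtain ⟨v, y, hy, hvy, hval, hdec, hcross⟩ :=
    exists_minimal_sequence hζ (zero_lt_one.trans hw) h
  obtain ⟨k, hk, hdet⟩ := exists_triple_ne_zero hζ hw hy hvy hval hdec hcross ⌈N⌉₊
  have hky : k + 1 ≤ y (k + 1) := hy.id_le _
  have hcast : ∀ j i, |(v j i : ℝ)| ≤ y j := fun j i => by exact_mod_cast hvy j i
  have hle : ∀ j, (y j : ℝ) ≤ y (j + 1) := fun j => by exact_mod_cast (hy j.lt_succ_self).le
  refine ⟨y (k + 1), y (k + 2), v k, v (k + 1), v (k + 2),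
    (Nat.le_ceil N).trans (by exact_mod_cast (by omega)),
    ⟨by exact_mod_cast (by omega), hle _, fun i => (hcast _ _).trans (hle _), hcast _, hcast _,
      hval _, hval _, (hdec _).le.trans (hval _), hdet⟩⟩

lemma abs_coeff_le_polyH (P : ℤ[X]) (i : ℕ) : |(P.coeff i : ℝ)| ≤ polyH P := by
  rw [← Int.cast_abs, Int.abs_eq_natAbs, Int.cast_natCast, polyH, Nat.cast_le]
  by_cases hi : i ∈ P.support
  · exact Finset.le_sup (f := fun i => (P.coeff i).natAbs) hi
  · simp [notMem_support_iff.1 hi]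

lemma one_le_polyH {P : ℤ[X]} (hP : P ≠ 0) : 1 ≤ polyH P := by
  refine le_trans ?_ (abs_coeff_le_polyH P P.natDegree)
  exact_mod_cast Int.one_le_abs (leadingCoeff_ne_zero.2 hP)

lemma exists_quadVal_le_of_lt_whExp {ζ w : ℝ} (hw : 0 < w) (hlt : w < whExp 2 ζ) :
    ∃ N : ℕ, ∀ n ≥ N, ∃ v : Fin 3 → ℤ, v ≠ 0 ∧ (∀ i, |v i| ≤ n) ∧
      |quadVal ζ v| ≤ (n : ℝ) ^ (-w) := by
  have hne : (whSet 2 ζ).Nonempty := by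
    by_contra hne
    rw [whExp, Set.not_nonempty_iff_eq_empty.1 hne, Real.sSup_empty] at hlt
    exact absurd hlt (not_lt.2 hw.le)
  obtain ⟨η, ⟨X₀, hX₀⟩, hη⟩ := exists_lt_of_lt_csSup hne hlt
  refine ⟨max ⌈X₀⌉₊ 1, fun n hn => ?_⟩
  have hn0 : X₀ ≤ n :=
    (Nat.le_ceil X₀).trans (by exact_mod_cast le_of_max_le_left hn)
  have hn1 : (1 : ℝ) ≤ n := by exact_mod_cast le_of_max_le_right hn
  obtain ⟨P, hdeg, hH, hpos, hle⟩ := hX₀ n hn0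
  have hval : quadVal ζ (fun i => P.coeff i) = pev ζ P := by
    rw [pev, aeval_eq_sum_range' (Nat.lt_succ_of_le hdeg), quadVal]
    simp [Finset.sum_range_succ]
  refine ⟨fun i => P.coeff i, fun h0 => ?_, fun i => ?_, ?_⟩
  · rw [← hval, h0] at hpos
    simp [quadVal] at hpos
  · exact_mod_cast (abs_coeff_le_polyH P i).trans hH
  · rw [hval]
    exact hle.trans (Real.rpow_le_rpow_of_exponent_le hn1 (by linarith))

lemma abs_aeval_le_of_root {P : ℤ[X]} (hdeg : P.natDegree = 3) {α ζ : ℝ}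
    (hα : aeval α P = 0) (hd : |ζ - α| ≤ 1) :
    |aeval ζ P| ≤ |ζ - α| * (polyH P * (1 + 2 * (|ζ| + 1) + 3 * (|ζ| + 1) ^ 2)) := by
  set m := |ζ| + 1 with hm
  have hζm : |ζ| ≤ m := by linarith
  have hαm : |α| ≤ m := by
    have := abs_sub_abs_le_abs_sub α ζ
    rw [abs_sub_comm] at this
    linarith
  have hm0 : 0 ≤ m := (abs_nonneg _).trans hζm
  have e : aeval ζ P = (ζ - α) * (P.coeff 1 + P.coeff 2 * (ζ + α) +
      P.coeff 3 * (ζ * ζ + ζ * α + α * α)) := by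
    rw [← sub_zero (aeval ζ P), ← hα, aeval_eq_sum_range, aeval_eq_sum_range, hdeg]
    simp [Finset.sum_range_succ]
    ring
  rw [e, abs_mul]
  refine mul_le_mul_of_nonneg_left ?_ (abs_nonneg _)
  have hH : 0 ≤ polyH P := (abs_nonneg _).trans (abs_coeff_le_polyH P 0)
  have t1 : |ζ + α| ≤ 2 * m := (abs_add_le _ _).trans (by linarith)
  have tm : ∀ x y : ℝ, |x| ≤ m → |y| ≤ m → |x * y| ≤ m ^ 2 := fun x y hx hy => by
    rw [abs_mul, sq]
    exact mul_le_mul hx hy (abs_nonneg _) hm0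
  have t2 : |ζ * ζ + ζ * α + α * α| ≤ 3 * m ^ 2 := by
    refine (abs_add_three _ _ _).trans ?_
    linarith [tm ζ ζ hζm hζm, tm ζ α hζm hαm, tm α α hαm hαm]
  have u2 := mul_le_mul (abs_coeff_le_polyH P 2) t1 (abs_nonneg _) hH
  have u3 := mul_le_mul (abs_coeff_le_polyH P 3) t2 (abs_nonneg _) hH
  rw [← abs_mul] at u2 u3
  refine (abs_add_three _ _ _).trans ?_
  linarith [abs_coeff_le_polyH P 1]

/-- An exponent close to `(3 + √5) / 2` for which the final size estimates hold. -/
lemma exists_exponent {δ ε : ℝ} (hδ : 0 < δ) (hε : 0 < ε) : ∃ w : ℝ, 2 < w ∧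
    w < (3 + √5) / 2 ∧ (w - 1)⁻¹ + 2 - δ - w < 0 ∧ 2 * (w - 1)⁻¹ + 1 - √5 - ε < 0 := by
  have h5 : √5 ^ 2 = 5 := Real.sq_sqrt (by norm_num)
  have h2 : 2 < √5 := Real.lt_sqrt_of_sq_lt (by norm_num)
  have hinv : ((3 + √5) / 2 - 1)⁻¹ = (√5 - 1) / 2 :=
    inv_eq_of_mul_eq_one_right (by linear_combination h5 / 4)
  have hne : (3 + √5) / 2 - 1 ≠ 0 := by linarith
  have hc : ContinuousAt (fun w : ℝ => (w - 1)⁻¹) ((3 + √5) / 2) :=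
    (continuousAt_id.sub continuousAt_const).inv₀ hne
  have c1 : ContinuousAt (fun w : ℝ => (w - 1)⁻¹ + 2 - δ - w) ((3 + √5) / 2) :=
    ((hc.add continuousAt_const).sub continuousAt_const).sub continuousAt_id
  have c2 : ContinuousAt (fun w : ℝ => 2 * (w - 1)⁻¹ + 1 - √5 - ε) ((3 + √5) / 2) :=
    (((continuousAt_const.mul hc).add continuousAt_const).sub continuousAt_const).sub
      continuousAt_const
  have l1 := c1.eventually_lt_const (u := 0) (by simp only [hinv]; linarith)
  have l2 := c2.eventually_lt_const (u := 0) (by simp only [hinv]; linarith)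
  have l3 := eventually_gt_nhds (show 2 < (3 + √5) / 2 by linarith)
  obtain ⟨w, hw, h⟩ := ((Filter.Eventually.filter_mono nhdsWithin_le_nhds
    (l3.and (l1.and l2))).and (self_mem_nhdsWithin (s := Set.Iio ((3 + √5) / 2)))).exists
  exact ⟨w, hw.1, h, hw.2.1, hw.2.2⟩

lemma exists_forall_ge_mul_rpow_lt {a : ℝ} (C : ℝ) (ha : a < 0) {c : ℝ} (hc : 0 < c) :
    ∃ N : ℝ, ∀ x ≥ N, C * x ^ a < c := by
  have h := (tendsto_rpow_neg_atTop (neg_pos.2 ha)).const_mul C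
  rw [neg_neg, mul_zero] at h
  exact Filter.eventually_atTop.1 (h.eventually_lt_const hc)

theorem extremal_cubic_alg_uniform_gap (ζ : ℝ) (hζ : IsExtremal ζ) (ε : ℝ) (hε : 0 < ε) :
    ∀ X₀ : ℝ, ∃ X : ℝ, X₀ ≤ X ∧
      ¬ ∃ α : ℝ, ∃ P : Polynomial ℤ, Irreducible P ∧ P.natDegree = 3 ∧ pev α P = 0 ∧
        polyH P ≤ X ∧ |ζ - α| ≤ (polyH P)⁻¹ * X ^ (-Real.sqrt 5 - ε) := by
  intro X₀
  obtain ⟨htr, hexp⟩ := hζ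
  have h5 : 0 < √5 := by positivity
  set δ := ε / (2 * (√5 + ε)) with hδdef
  have hδ : 0 < δ := by positivity
  have hδε : δ * (√5 + ε) = ε / 2 := by
    rw [hδdef]
    field_simp
  have hδ1 : δ < 1 := by nlinarith
  obtain ⟨w, hw2, hw, he1, he2⟩ := exists_exponent hδ (half_pos hε)
  rw [← hexp] at hw
  set κ := (w - 1)⁻¹ with hκ
  have hw1 : 0 < w - 1 := by linarith
  have hκ0 : 0 < κ := inv_pos.2 hw1
  set K : ℝ := 2 ^ w with hKdef
  have hK : 0 < K := by positivity
  set G : ℝ := (6 * K) ^ κ with hG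
  have hG0 : 0 < G := by positivity
  set C₁ : ℝ := 1 + 2 * (|ζ| + 1) + 3 * (|ζ| + 1) ^ 2 with hC₁
  have hC₁0 : 0 < C₁ := by positivity
  obtain ⟨N₁, hN₁⟩ := exists_forall_ge_mul_rpow_lt ((12 + 4 * |ζ|) * K)
    (by linarith : 2 - w < 0) one_pos
  obtain ⟨N₂, hN₂⟩ := exists_forall_ge_mul_rpow_lt (6 * ((2 + 2 * |ζ|) * K * G)) he1
    (half_pos one_pos)
  obtain ⟨N₃, hN₃⟩ := exists_forall_ge_mul_rpow_lt (6 * (C₁ * G ^ 2)) he2 (half_pos one_pos)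
  obtain ⟨N₄, hN₄⟩ := Filter.eventually_atTop.1
    ((tendsto_rpow_atTop (sub_pos.2 hδ1)).eventually_ge_atTop X₀)
  obtain ⟨Y, Z, s, q, r, hNY, htriple⟩ := exists_isMinimalTriple htr (by linarith : 1 < w)
    (exists_quadVal_le_of_lt_whExp (by linarith) hw) (max (max N₁ N₂) (max N₃ N₄))
  simp only [max_le_iff] at hNY
  obtain ⟨⟨hY₁, hY₂⟩, hY₃, hY₄⟩ := hNY
  have hY := htriple.one_le
  have hYZ := htriple.le
  have hY0 : 0 < Y := by linarith
  have hZ1 : 1 ≤ Z := by linarith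
  have hZ0 : 0 < Z := by linarith
  have hsmall : (12 + 4 * |ζ|) * (K * Y ^ (-w) * Y ^ 2) < 1 := by
    have := hN₁ Y hY₁
    rw [sub_eq_neg_add, Real.rpow_add hY0, Real.rpow_two] at this
    linarith
  have hYle : Y ≤ G * Z ^ κ := by
    have h1 := htriple.one_le_mul (by linarith) hK.le
    have h2 : Y ^ (w - 1) ≤ 6 * K * Z := by
      have h3 : Y ^ (w - 1) * (Y ^ (-w) * Y) = 1 := by
        rw [← Real.rpow_add_one hY0.ne', ← Real.rpow_add hY0]
        simp
      have h4 : 0 ≤ Y ^ (w - 1) := by positivity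
      have h6 := mul_le_mul_of_nonneg_left h1 h4
      linear_combination h6 + 6 * K * Z * h3
    calc Y = (Y ^ (w - 1)) ^ κ := by rw [← Real.rpow_mul hY0.le, mul_inv_cancel₀ hw1.ne',
          Real.rpow_one]
      _ ≤ (6 * K * Z) ^ κ := Real.rpow_le_rpow (by positivity) h2 hκ0.le
      _ = G * Z ^ κ := Real.mul_rpow (by positivity) hZ0.le
  refine ⟨Z ^ (1 - δ), hN₄ Z (by linarith), ?_⟩
  rintro ⟨α, P, hP, hdeg, hα, hH, hle⟩
  have hX1 : 1 ≤ Z ^ (1 - δ) := Real.one_le_rpow hZ1 (by linarith)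
  have hXval : (Z ^ (1 - δ)) ^ (-√5 - ε) = Z ^ (-√5 - ε / 2) := by
    rw [← Real.rpow_mul hZ0.le]
    congr 1
    linear_combination hδε
  have hH1 := one_le_polyH hP.ne_zero
  have hdist : |ζ - α| ≤ 1 := hle.trans (mul_le_one₀ (inv_le_one_of_one_le₀ hH1) (by positivity)
    (Real.rpow_le_one_of_one_le_of_nonpos hX1 (by linarith)))
  have hval : |aeval ζ P| ≤ C₁ * Z ^ (-√5 - ε / 2) := by
    refine (abs_aeval_le_of_root hdeg hα hdist).trans ?_
    rw [hXval] at hle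
    calc |ζ - α| * (polyH P * C₁) ≤
          (polyH P)⁻¹ * Z ^ (-√5 - ε / 2) * (polyH P * C₁) := by gcongr
      _ = C₁ * Z ^ (-√5 - ε / 2) := by field_simp
  have hmain := htriple.one_le_of_irreducible (by linarith) hK.le hsmall hP hdeg
    (fun i => (abs_coeff_le_polyH P i).trans hH)
  have b1 : K * Z ^ (-w) * Y * Z ^ (1 - δ) * Z ≤ K * G * Z ^ (κ + 2 - δ - w) := by
    calc K * Z ^ (-w) * Y * Z ^ (1 - δ) * Z ≤
          K * Z ^ (-w) * (G * Z ^ κ) * Z ^ (1 - δ) * Z := by gcongr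
      _ = K * G * (Z ^ (-w) * Z ^ κ * Z ^ (1 - δ) * Z) := by ring
      _ = K * G * Z ^ (κ + 2 - δ - w) := by
          rw [← Real.rpow_add hZ0, ← Real.rpow_add hZ0, ← Real.rpow_add_one hZ0.ne']
          ring_nf
  have b2 : |aeval ζ P| * (Y * Y * Z) ≤ C₁ * G ^ 2 * Z ^ (2 * κ + 1 - √5 - ε / 2) := by
    calc |aeval ζ P| * (Y * Y * Z) ≤
          C₁ * Z ^ (-√5 - ε / 2) * (G * Z ^ κ * (G * Z ^ κ) * Z) := by gcongr
      _ = C₁ * G ^ 2 * (Z ^ (-√5 - ε / 2) * Z ^ κ * Z ^ κ * Z) := by ring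
      _ = C₁ * G ^ 2 * Z ^ (2 * κ + 1 - √5 - ε / 2) := by
          rw [← Real.rpow_add hZ0, ← Real.rpow_add hZ0, ← Real.rpow_add_one hZ0.ne']
          ring_nf
  have f1 := hN₂ Z (hY₂.trans hYZ)
  have f2 := hN₃ Z (hY₃.trans hYZ)
  have b3 := mul_le_mul_of_nonneg_left b1 (by positivity : 0 ≤ 2 + 2 * |ζ|)
  linarith
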